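/- Let R be a commutative ring that is an integral domain and a finitely generated ℂ-algebra. If f ∈ R satisfies D f = 0, where D : R → Ω_{R/ℂ} is the universal derivation into the module of Kähler differentials of R over ℂ, then f lies in the image of the structure map ℂ → R; that is, f is a constant. -/

import Mathlib

open TensorProduct in
/-- On an integral domain that is a finitely generated `ℂ`-algebra, an element whose
Kähler differential vanishes is a constant, i.e. lies in the image of `ℂ`. -/
theorem constant_of_kaehlerDifferential_eq_zero
    (R : Type*) [CommRing R] [IsDomain R] [Algebra ℂ R] [Algebra.FiniteType ℂ R]
    (f : R) (hf : KaehlerDifferential.D ℂ R f = 0) :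
    f ∈ Set.range (algebraMap ℂ R) := by
  by_cases halg : IsAlgebraic ℂ f
  · have hint : IsIntegral ℂ f := halg.isIntegral
    have hdeg := IsAlgClosed.degree_eq_one_of_irreducible ℂ (minpoly.irreducible hint)
    exact minpoly.mem_range_of_degree_eq_one ℂ f hdeg
  exfalso
  have hinj : Function.Injective (Polynomial.aeval (R := ℂ) f) :=
    transcendental_iff_injective.mp halg
  let K := FractionRing R
  let S := Polynomial ℂ
  let F := FractionRing S
  let g : S →ₐ[ℂ] K := (IsScalarTower.toAlgHom ℂ R K).comp (Polynomial.aeval f)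
  have hg : Function.Injective g := (IsFractionRing.injective R K).comp hinj
  letI : Algebra S K := g.toRingHom.toAlgebra
  haveI : IsScalarTower ℂ S K := IsScalarTower.of_algebraMap_eq' g.comp_algebraMap.symm
  haveI : FaithfulSMul S K := (faithfulSMul_iff_algebraMap_injective S K).mpr hg
  letI : Algebra F K := FractionRing.liftAlgebra S K
  haveI : IsScalarTower S F K := FractionRing.isScalarTower_liftAlgebra S K
  haveI : IsScalarTower ℂ F K := IsScalarTower.to₁₃₄ ℂ S F K
  haveI : Algebra.EssFiniteType R K := Algebra.EssFiniteType.of_isLocalization K (nonZeroDivisors R)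
  haveI : Algebra.EssFiniteType ℂ K := Algebra.EssFiniteType.comp ℂ R K
  haveI : Algebra.EssFiniteType F K := Algebra.EssFiniteType.of_comp ℂ F K
  haveI : CharZero F := charZero_of_injective_algebraMap (algebraMap ℂ F).injective
  haveI : Algebra.FormallySmooth F K := Algebra.FormallySmooth.of_perfectField
  haveI : Algebra.FormallySmooth S F := Algebra.FormallySmooth.of_isLocalization (nonZeroDivisors S)
  haveI : Algebra.FormallySmooth S K := Algebra.FormallySmooth.comp S F K
  have hX : algebraMap S K Polynomial.X = algebraMap R K f := by
    change algebraMap R K (Polynomial.aeval f Polynomial.X) = _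
    simp
  have h0 : KaehlerDifferential.mapBaseChange ℂ S K
      (1 ⊗ₜ KaehlerDifferential.D ℂ S Polynomial.X) = 0 := by
    rw [KaehlerDifferential.mapBaseChange_tmul, one_smul, KaehlerDifferential.map_D, hX,
      ← KaehlerDifferential.map_D ℂ ℂ R K, hf, map_zero]
  obtain ⟨x, hx⟩ := (Algebra.H1Cotangent.exact_δ_mapBaseChange ℂ S K _).mp h0
  rw [Subsingleton.elim x 0, map_zero] at hx
  have h1 := congrArg (fun z => TensorProduct.rid S K
    ((KaehlerDifferential.polynomialEquiv ℂ).toLinearMap.lTensor K z)) hx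
  simp [KaehlerDifferential.polynomialEquiv_D, S] at h1
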